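/- Lemma 2: Let k be a field, B a Hopf algebra over k with antipode S, (E,ρ) a right B-comodule algebra, and (M,ρ_M) a left B-comodule. Let T be a ρ-compatible left Ore set in E with localized coaction ρ_T on E_T := T⁻¹E, and let γ : B → E_T be a B-comodule algebra homomorphism, i.e. a k-algebra homomorphism with ρ_T ∘ γ = (γ ⊗ id_B) ∘ Δ. Define κ : E_T^{coB} ⊗ M → E_T ⊗ M by κ(f ⊗ m) = Σ f·γ(m₍₋₁₎) ⊗ m₍₀₎. Then for every H in the cotensor product E □_B M = {H ∈ E ⊗ M : (ρ ⊗ id_M)(H) = (id_E ⊗ ρ_M)(H)}, the element (i_T ⊗ id_M)(H) of E_T ⊗ M lies in the image of κ. -/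

import Mathlib

open scoped TensorProduct

/-- A multiplicative subset `S` of a unital ring `R` is a *left Ore set*. -/
structure IsLeftOreSet {R : Type*} [Ring R] (S : Set R) : Prop where
  one_mem : (1 : R) ∈ S
  mul_mem : ∀ ⦃s t : R⦄, s ∈ S → t ∈ S → s * t ∈ S
  zero_not_mem : (0 : R) ∉ S
  ore : ∀ s ∈ S, ∀ r : R, ∃ s' ∈ S, ∃ r' : R, r' * s = s' * r
  reversible : ∀ (n : R), ∀ s ∈ S, n * s = 0 → ∃ s' ∈ S, s' * n = 0

/-- `i : R →+* Q` realizes `Q` as the left Ore localization `S⁻¹R`. -/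
structure IsLeftOreRingLocalization {R : Type*} [Ring R] (S : Set R)
    {Q : Type*} [Ring Q] (i : R →+* Q) : Prop where
  isUnit : ∀ s ∈ S, IsUnit (i s)
  surj : ∀ x : Q, ∃ s ∈ S, ∃ r : R, i s * x = i r
  ker : ∀ r : R, i r = 0 ↔ ∃ s ∈ S, s * r = 0

/-- `(E, ρ)` is a right `B`-comodule algebra. -/
structure IsComoduleAlgebra (k : Type*) [CommRing k]
    (B : Type*) [Ring B] [Bialgebra k B]
    {E : Type*} [Ring E] [Algebra k E]
    (ρ : E →ₐ[k] E ⊗[k] B) : Prop where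
  coassoc : ∀ e : E,
      TensorProduct.assoc k E B B (TensorProduct.map ρ.toLinearMap LinearMap.id (ρ e))
        = TensorProduct.map LinearMap.id (Coalgebra.comul (R := k) (A := B)) (ρ e)
  counit : ∀ e : E,
      TensorProduct.rid k E
        (TensorProduct.map LinearMap.id (Coalgebra.counit (R := k) (A := B)) (ρ e)) = e

/-- `(M, ρM)` is a left `B`-comodule. -/
structure IsLeftComodule (k : Type*) [CommRing k]
    (B : Type*) [Ring B] [Bialgebra k B]
    {M : Type*} [AddCommGroup M] [Module k M]
    (ρM : M →ₗ[k] B ⊗[k] M) : Prop where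
  coassoc : ∀ m : M,
      TensorProduct.map (Coalgebra.comul (R := k) (A := B)) LinearMap.id (ρM m)
        = (TensorProduct.assoc k B B M).symm (TensorProduct.map LinearMap.id ρM (ρM m))
  counit : ∀ m : M,
      TensorProduct.lid k M
        (TensorProduct.map (Coalgebra.counit (R := k) (A := B)) LinearMap.id (ρM m)) = m

/-- The coinvariants `A^{co B}` of a right `B`-comodule algebra, as a `k`-submodule. -/
def coinvariants (k : Type*) [CommRing k] {B : Type*} [Ring B] [Bialgebra k B]
    {A : Type*} [Ring A] [Algebra k A] (ρ : A →ₐ[k] A ⊗[k] B) : Submodule k A where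
  carrier := {a | ρ a = a ⊗ₜ[k] (1 : B)}
  add_mem' := by
    intro a b ha hb
    simp only [Set.mem_setOf_eq] at *
    rw [map_add, ha, hb, TensorProduct.add_tmul]
  zero_mem' := by
    simp only [Set.mem_setOf_eq, map_zero, TensorProduct.zero_tmul]
  smul_mem' := by
    intro c a ha
    simp only [Set.mem_setOf_eq] at *
    rw [map_smul, ha, TensorProduct.smul_tmul']

/-- The map `κ : A^{co B} ⊗ M → A ⊗ M`, `f ⊗ m ↦ Σ f·γ(m₍₋₁₎) ⊗ m₍₀₎`. -/
noncomputable def kappaCoinv (k : Type*) [CommRing k]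
    {B : Type*} [Ring B] [Bialgebra k B]
    {A : Type*} [Ring A] [Algebra k A] (ρA : A →ₐ[k] A ⊗[k] B)
    {M : Type*} [AddCommGroup M] [Module k M] (ρM : M →ₗ[k] B ⊗[k] M)
    (γ : B →ₐ[k] A) :
    (coinvariants k ρA) ⊗[k] M →ₗ[k] A ⊗[k] M :=
  (TensorProduct.map
      ((LinearMap.mul' k A) ∘ₗ
        TensorProduct.map (coinvariants k ρA).subtype γ.toLinearMap)
      LinearMap.id) ∘ₗ
    ((TensorProduct.assoc k (coinvariants k ρA) B M).symm.toLinearMap) ∘ₗ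
    (TensorProduct.map LinearMap.id ρM)

noncomputable def convAct {k B A M : Type*} [Field k] [Ring B] [HopfAlgebra k B]
    [Ring A] [Algebra k A] [AddCommGroup M] [Module k M] (ρM : M →ₗ[k] B ⊗[k] M)
    (f : WithConv (B →ₗ[k] A)) : A ⊗[k] M →ₗ[k] A ⊗[k] M :=
  TensorProduct.map (LinearMap.mul' k A ∘ₗ TensorProduct.map LinearMap.id f.ofConv) LinearMap.id ∘ₗ
    (TensorProduct.assoc k A B M).symm.toLinearMap ∘ₗ TensorProduct.map LinearMap.id ρM

section convActLemmas
open WithConv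

variable {k B A A' M : Type*} [Field k] [Ring B] [HopfAlgebra k B]
    [Ring A] [Algebra k A] [Ring A'] [Algebra k A'] [AddCommGroup M] [Module k M]
    (ρM : M →ₗ[k] B ⊗[k] M)

lemma convAct_tmul (f : WithConv (B →ₗ[k] A)) (a : A) (m : M) :
    convAct ρM f (a ⊗ₜ m) =
      TensorProduct.map (LinearMap.mulLeft k a ∘ₗ f.ofConv) LinearMap.id (ρM m) := by
  simp only [convAct, LinearMap.comp_apply, TensorProduct.map_tmul, LinearMap.id_apply,
    LinearEquiv.coe_coe]
  induction ρM m using TensorProduct.induction_on with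
  | zero => simp
  | tmul b n => simp
  | add x y hx hy => rw [TensorProduct.tmul_add, map_add, map_add, map_add, hx, hy]

lemma convAct_mul (hM : IsLeftComodule k B ρM) (f g : WithConv (B →ₗ[k] A)) (x : A ⊗[k] M) :
    convAct ρM f (convAct ρM g x) = convAct ρM (g * f) x := by
  induction x using TensorProduct.induction_on with
  | zero => simp
  | add x y hx hy => rw [map_add, map_add, map_add, hx, hy]
  | tmul a m =>
    rw [convAct_tmul, convAct_tmul]
    have h1 : ∀ x : B ⊗[k] M,
        convAct ρM f (TensorProduct.map (LinearMap.mulLeft k a ∘ₗ g.ofConv) LinearMap.id x) =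
        TensorProduct.map (LinearMap.mul' k A ∘ₗ
          TensorProduct.map (LinearMap.mulLeft k a ∘ₗ g.ofConv) f.ofConv) LinearMap.id
          ((TensorProduct.assoc k B B M).symm (TensorProduct.map LinearMap.id ρM x)) := by
      intro x
      induction x using TensorProduct.induction_on with
      | zero => simp
      | add x y hx hy => simp only [map_add, hx, hy]
      | tmul b n =>
        rw [TensorProduct.map_tmul, LinearMap.id_apply, convAct_tmul, TensorProduct.map_tmul]
        induction ρM n using TensorProduct.induction_on with
        | zero => simp
        | tmul b n => simp [mul_assoc]
        | add x y hx hy => rw [map_add, TensorProduct.tmul_add, map_add, map_add, hx, hy]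
    rw [h1, ← hM.coassoc, ← LinearMap.comp_apply, ← TensorProduct.map_comp]
    congr 2
    ext b
    simp only [LinearMap.comp_apply, LinearMap.convMul_def]
    induction Coalgebra.comul (R := k) b using TensorProduct.induction_on with
    | zero => simp
    | tmul b n => simp [mul_assoc]
    | add x y hx hy => simp only [map_add, hx, hy]

lemma convAct_one (hM : IsLeftComodule k B ρM) (x : A ⊗[k] M) :
    convAct ρM (1 : WithConv (B →ₗ[k] A)) x = x := by
  induction x using TensorProduct.induction_on with
  | zero => simp
  | add x y hx hy => rw [map_add, hx, hy]
  | tmul a m =>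
    rw [convAct_tmul]
    conv_rhs => rw [← hM.counit m]
    induction ρM m using TensorProduct.induction_on with
    | zero => simp
    | tmul b n =>
      simp [LinearMap.convOne_def, Algebra.algebraMap_eq_smul_one, TensorProduct.smul_tmul]
    | add x y hx hy => simp only [map_add, hx, hy, TensorProduct.tmul_add]

lemma map_convAct (φ : A →ₐ[k] A') (f : WithConv (B →ₗ[k] A)) (x : A ⊗[k] M) :
    TensorProduct.map φ.toLinearMap LinearMap.id (convAct ρM f x) =
      convAct ρM (toConv (φ.toLinearMap ∘ₗ f.ofConv))
        (TensorProduct.map φ.toLinearMap LinearMap.id x) := by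
  induction x using TensorProduct.induction_on with
  | zero => simp
  | add x y hx hy => simp only [map_add, hx, hy]
  | tmul a m =>
    rw [TensorProduct.map_tmul, convAct_tmul, LinearMap.id_apply, convAct_tmul]
    induction ρM m using TensorProduct.induction_on with
    | zero => simp
    | tmul b n => simp
    | add x y hx hy => simp only [map_add, hx, hy]

lemma conv_antipode_left (γ : B →ₐ[k] A) :
    toConv (γ.toLinearMap ∘ₗ HopfAlgebra.antipode k (A := B)) * toConv γ.toLinearMap = 1 := by
  have h := LinearMap.algHom_comp_convMul_distrib γ
    (toConv (HopfAlgebra.antipode k (A := B))) (toConv LinearMap.id)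
  rw [LinearMap.antipode_mul_id] at h
  apply WithConv.ext
  refine Eq.trans h.symm ?_
  ext b; simp [LinearMap.convOne_def]

lemma conv_antipode_right (γ : B →ₐ[k] A) :
    toConv γ.toLinearMap * toConv (γ.toLinearMap ∘ₗ HopfAlgebra.antipode k (A := B)) = 1 := by
  have h := LinearMap.algHom_comp_convMul_distrib γ
    (toConv LinearMap.id) (toConv (HopfAlgebra.antipode k (A := B)))
  rw [LinearMap.id_mul_antipode] at h
  apply WithConv.ext
  refine Eq.trans h.symm ?_
  ext b; simp [LinearMap.convOne_def]

lemma conv_key (γ : B →ₐ[k] A) (θ : B →ₐ[k] A ⊗[k] B)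
    (hθ : ∀ b : B, θ b =
      TensorProduct.map γ.toLinearMap LinearMap.id (Coalgebra.comul (R := k) (A := B) b)) :
    toConv ((Algebra.TensorProduct.includeRight : B →ₐ[k] A ⊗[k] B).toLinearMap) *
      toConv (θ.toLinearMap ∘ₗ HopfAlgebra.antipode k (A := B)) =
    toConv ((Algebra.TensorProduct.includeLeft : A →ₐ[k] A ⊗[k] B).toLinearMap ∘ₗ
      γ.toLinearMap ∘ₗ HopfAlgebra.antipode k (A := B)) := by
  have h : toConv ((Algebra.TensorProduct.includeLeft : A →ₐ[k] A ⊗[k] B).toLinearMap ∘ₗ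
      γ.toLinearMap ∘ₗ HopfAlgebra.antipode k (A := B)) * toConv θ.toLinearMap =
      toConv ((Algebra.TensorProduct.includeRight : B →ₐ[k] A ⊗[k] B).toLinearMap) := by
    have e : θ.toLinearMap = TensorProduct.map γ.toLinearMap LinearMap.id ∘ₗ
      (Coalgebra.comul (R := k) (A := B)) := LinearMap.ext hθ
    ext b
    have h1 : ∀ x : B ⊗[k] B, LinearMap.mul' k (A ⊗[k] B) (TensorProduct.map
        ((Algebra.TensorProduct.includeLeft : A →ₐ[k] A ⊗[k] B).toLinearMap ∘ₗ
          γ.toLinearMap ∘ₗ HopfAlgebra.antipode k (A := B)) θ.toLinearMap x) =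
        TensorProduct.map (LinearMap.mul' k A ∘ₗ TensorProduct.map
          (γ.toLinearMap ∘ₗ HopfAlgebra.antipode k (A := B)) γ.toLinearMap) LinearMap.id
          ((TensorProduct.assoc k B B B).symm ((Coalgebra.comul (R := k)).lTensor B x)) := by
      intro x
      induction x using TensorProduct.induction_on with
      | zero => simp
      | add x y hx hy => simp only [map_add, hx, hy]
      | tmul b n =>
        rw [e, TensorProduct.map_tmul, LinearMap.comp_apply (g := Coalgebra.comul), LinearMap.lTensor_tmul]
        induction Coalgebra.comul (R := k) n using TensorProduct.induction_on with
        | zero => simp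
        | tmul b n => simp
        | add x y hx hy => simp only [map_add, TensorProduct.tmul_add, hx, hy]
    refine (h1 _).trans ?_
    rw [Coalgebra.coassoc_symm_apply, LinearMap.rTensor, ← LinearMap.comp_apply,
      ← TensorProduct.map_comp]
    have h2 := congrArg WithConv.ofConv (conv_antipode_left γ)
    have h3 : (LinearMap.mul' k A ∘ₗ TensorProduct.map
          (γ.toLinearMap ∘ₗ HopfAlgebra.antipode k (A := B)) γ.toLinearMap) ∘ₗ Coalgebra.comul
          = Algebra.linearMap k A ∘ₗ Coalgebra.counit := h2
    rw [h3, TensorProduct.map_comp, LinearMap.comp_apply]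
    have h4 := Coalgebra.rTensor_counit_comul (R := k) b
    rw [LinearMap.rTensor] at h4
    rw [h4]
    simp
  rw [← h, mul_assoc, conv_antipode_right, mul_one]

end convActLemmas

/-- **Lemma 2.** Let `B` be a Hopf algebra over a field `k`, `(E, ρ)` a right
`B`-comodule algebra, `(M, ρM)` a left `B`-comodule, `T` a `ρ`-compatible left Ore set in
`E` with localized coaction `ρT` on `E_T = T⁻¹E`, and `γ : B → E_T` a `B`-comodule
algebra homomorphism.  Then for every `H` in the cotensor product
`E □_B M = {H ∈ E ⊗ M : (ρ ⊗ id)(H) = (id ⊗ ρM)(H)}`, the element `(i_T ⊗ id)(H)` of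
`E_T ⊗ M` lies in the image of `κ : E_T^{co B} ⊗ M → E_T ⊗ M`. -/
theorem cotensor_maps_into_image_of_kappa
    {k : Type*} [Field k] {B : Type*} [Ring B] [HopfAlgebra k B]
    {E : Type*} [Ring E] [Algebra k E]
    (ρ : E →ₐ[k] E ⊗[k] B) (hρ : IsComoduleAlgebra k B ρ)
    {M : Type*} [AddCommGroup M] [Module k M]
    (ρM : M →ₗ[k] B ⊗[k] M) (hM : IsLeftComodule k B ρM)
    {T : Set E} (hT : IsLeftOreSet T)
    {Q : Type*} [Ring Q] [Algebra k Q]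
    (iT : E →ₐ[k] Q) (hloc : IsLeftOreRingLocalization T iT.toRingHom)
    (ρT : Q →ₐ[k] Q ⊗[k] B) (hρT : IsComoduleAlgebra k B ρT)
    (hcompat : ∀ e : E, ρT (iT e) = Algebra.TensorProduct.map iT (AlgHom.id k B) (ρ e))
    (γ : B →ₐ[k] Q)
    (hγ : ∀ b : B, ρT (γ b) =
      TensorProduct.map γ.toLinearMap LinearMap.id (Coalgebra.comul (R := k) (A := B) b)) :
    ∀ H : E ⊗[k] M,
      TensorProduct.assoc k E B M (TensorProduct.map ρ.toLinearMap LinearMap.id H)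
          = TensorProduct.map LinearMap.id ρM H →
      ∃ w : (coinvariants k ρT) ⊗[k] M,
        kappaCoinv k ρT ρM γ w = TensorProduct.map iT.toLinearMap LinearMap.id H := by
  intro H hH
  set H' := TensorProduct.map iT.toLinearMap (LinearMap.id : M →ₗ[k] M) H with hH'
  let gS : WithConv (B →ₗ[k] Q) :=
    WithConv.toConv (γ.toLinearMap ∘ₗ HopfAlgebra.antipode k (A := B))
  let ι : Q →ₐ[k] Q ⊗[k] B := Algebra.TensorProduct.includeLeft
  let j : B →ₐ[k] Q ⊗[k] B := Algebra.TensorProduct.includeRight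
  have hco : TensorProduct.map ρT.toLinearMap (LinearMap.id : M →ₗ[k] M) H' =
      convAct ρM (WithConv.toConv j.toLinearMap)
        (TensorProduct.map ι.toLinearMap LinearMap.id H') := by
    apply (TensorProduct.assoc k Q B M).injective
    have e1 : ∀ x : E ⊗[k] M, TensorProduct.assoc k Q B M
        (TensorProduct.map ρT.toLinearMap (LinearMap.id : M →ₗ[k] M)
          (TensorProduct.map iT.toLinearMap (LinearMap.id : M →ₗ[k] M) x)) =
        TensorProduct.map iT.toLinearMap LinearMap.id (TensorProduct.assoc k E B M
          (TensorProduct.map ρ.toLinearMap LinearMap.id x)) := by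
      intro x
      induction x using TensorProduct.induction_on with
      | zero => simp
      | add x y hx hy => simp only [map_add, hx, hy]
      | tmul e m =>
        simp only [TensorProduct.map_tmul, LinearMap.id_apply, AlgHom.toLinearMap_apply, hcompat]
        induction ρ e using TensorProduct.induction_on with
        | zero => simp
        | tmul b n => simp
        | add x y hx hy => simp only [map_add, TensorProduct.add_tmul, hx, hy]
    have e2 : ∀ x : E ⊗[k] M, TensorProduct.assoc k Q B M
        (convAct ρM (WithConv.toConv j.toLinearMap)
        (TensorProduct.map ι.toLinearMap LinearMap.id
          (TensorProduct.map iT.toLinearMap (LinearMap.id : M →ₗ[k] M) x))) =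
        TensorProduct.map iT.toLinearMap LinearMap.id (TensorProduct.map LinearMap.id ρM x) := by
      intro x
      induction x using TensorProduct.induction_on with
      | zero => simp
      | add x y hx hy => simp only [map_add, hx, hy]
      | tmul e m =>
        simp only [TensorProduct.map_tmul, LinearMap.id_apply, AlgHom.toLinearMap_apply,
          convAct_tmul]
        induction ρM m using TensorProduct.induction_on with
        | zero => simp
        | tmul b n => simp [ι, j]
        | add x y hx hy => simp only [map_add, TensorProduct.tmul_add, hx, hy]
    rw [hH', e1, e2, hH]
  have hinv : TensorProduct.map ρT.toLinearMap (LinearMap.id : M →ₗ[k] M) (convAct ρM gS H') =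
      TensorProduct.map ι.toLinearMap LinearMap.id (convAct ρM gS H') := by
    rw [map_convAct, map_convAct, hco, convAct_mul ρM hM]
    congr 1
    exact congrArg (convAct ρM) (conv_key γ (ρT.comp γ) hγ)
  have hex : Function.Exact (coinvariants k ρT).subtype (ρT.toLinearMap - ι.toLinearMap) := by
    intro q
    simp only [LinearMap.sub_apply, sub_eq_zero, Submodule.coe_subtype, Subtype.range_coe_subtype]
    exact Iff.rfl
  have hex2 := Module.Flat.rTensor_exact M hex
  obtain ⟨w, hw⟩ := (hex2 (convAct ρM gS H')).1 (by
    rw [LinearMap.rTensor_sub, LinearMap.sub_apply, sub_eq_zero]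
    exact hinv)
  refine ⟨w, ?_⟩
  have hk : ∀ w, kappaCoinv k ρT ρM γ w = convAct ρM (WithConv.toConv γ.toLinearMap)
      ((coinvariants k ρT).subtype.rTensor M w) := by
    intro w
    induction w using TensorProduct.induction_on with
    | zero => simp
    | add x y hx hy => simp only [map_add, hx, hy]
    | tmul q m =>
      rw [LinearMap.rTensor_tmul, convAct_tmul]
      simp only [kappaCoinv, LinearMap.comp_apply, TensorProduct.map_tmul, LinearEquiv.coe_coe]
      induction ρM m using TensorProduct.induction_on with
      | zero => simp
      | tmul b n => simp
      | add x y hx hy => simp only [map_add, TensorProduct.tmul_add, hx, hy]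
  rw [hk, hw, convAct_mul ρM hM, conv_antipode_left, convAct_one ρM hM]
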